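/- Let n ≥ 1 be a natural number and let ∼ be an equivalence relation on [n] = {0,…,n} such that if i ∼ j then i+1 ≠ j and i ≠ j+1. Let n₀ = max{m ∈ [n] : m ∼ n, m < n} (and n₀ = −1 if no such m exists). Order each A_k^{(n)} lexicographically and let M^{(n)} pick from each class in C^{(n)} = ⋃_k C_k^{(n)} its lexicographically minimum representative; let Im M^{(m)} für m ≤ n denote the corresponding image sets for the restricted relation on [m], and let ψ_n: A^{(n−1)} → A^{(n)} append n, i.e., ψ_n(i_0,…,i_k) = (i_0,…,i_k,n). Then Im M^{(n)} is the disjoint union of Im M^{(n−1)} and ψ_n(Im M^{(n−1)} − Im M^{(n₀)}); in particular, ψ_n(Im M^{(n₀−1)}) ∩ Im M^{(n)} = ∅ and ψ_n(Im M^{(n₀)} − Im M^{(n₀−1)}) ∩ Im M^{(n)} = ∅. -/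

import Mathlib

/-- A strictly increasing tuple (recorded as a sorted list) with all entries `≤ m`;
the empty list records the empty tuple of `A_{-1}`. -/
def IsATuple (n : ℕ) (m : ℤ) (l : List (Fin (n + 1))) : Prop :=
  l.Chain' (· < ·) ∧ ∀ x ∈ l, (x : ℤ) ≤ m

/-- Some two adjacent entries of the tuple are `r`-related (membership in `B`). -/
def HasAdjRel {n : ℕ} (r : Fin (n + 1) → Fin (n + 1) → Prop) (l : List (Fin (n + 1))) : Prop :=
  ∃ (i : ℕ) (h : i + 1 < l.length), r (l.get ⟨i, Nat.lt_of_succ_lt h⟩) (l.get ⟨i + 1, h⟩)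

/-- `Im M^{(m)}`: the set of lexicographically minimal representatives of the
`≈`-classes of tuples in `A^{(m)} − B^{(m)}` (empty for `m < 0`, by convention). -/
def ImM {n : ℕ} (r : Fin (n + 1) → Fin (n + 1) → Prop) (m : ℤ) : Set (List (Fin (n + 1))) :=
  {l | 0 ≤ m ∧ IsATuple n m l ∧ ¬ HasAdjRel r l ∧
    ∀ l', IsATuple n m l' → ¬ HasAdjRel r l' → List.Forall₂ r l l' →
      ¬ List.Lex (· < ·) l' l}

namespace List

variable {α : Type*} [LinearOrder α]

theorem Forall₂.eq_or_lex_of_le {l l' : List α} (h : Forall₂ (· ≤ ·) l l') :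
    l = l' ∨ Lex (· < ·) l l' := by
  induction h with
  | nil => exact Or.inl rfl
  | cons hab _ ih =>
    rcases hab.lt_or_eq with hlt | rfl
    · exact Or.inr (.rel hlt)
    · rcases ih with rfl | ih
      · exact Or.inl rfl
      · exact Or.inr (.cons ih)

theorem Forall₂.not_lex_of_le {l l' : List α} (h : Forall₂ (· ≤ ·) l l') :
    ¬ Lex (· < ·) l' l := by
  induction h with
  | nil => exact fun h => nomatch h
  | cons hab _ ih =>
    intro hlex
    cases hlex with
    | rel hlt => exact absurd hlt hab.not_gt
    | cons hlex => exact ih hlex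

theorem Forall₂.zipWith_min_le_left {S : α → α → Prop} {l l' : List α} (h : Forall₂ S l l') :
    Forall₂ (· ≤ ·) (zipWith min l l') l := by
  induction h with
  | nil => exact .nil
  | cons _ _ ih => exact .cons (min_le_left _ _) ih

theorem Forall₂.zipWith_min_le_right {S : α → α → Prop} {l l' : List α} (h : Forall₂ S l l') :
    Forall₂ (· ≤ ·) (zipWith min l l') l' := by
  induction h with
  | nil => exact .nil
  | cons _ _ ih => exact .cons (min_le_right _ _) ih

theorem Forall₂.zipWith_min_of_refl {S : α → α → Prop} (hS : ∀ a, S a a) {l l' : List α}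
    (h : Forall₂ S l l') : Forall₂ S l (zipWith min l l') := by
  induction h with
  | nil => exact .nil
  | @cons a b _ _ hab _ ih =>
    refine .cons ?_ ih
    rcases min_choice a b with h | h <;> rw [h]
    exacts [hS a, hab]

theorem Forall₂.forall_mem_le {l l' : List α} (h : Forall₂ (· ≤ ·) l l') {p : α → Prop}
    (hp : ∀ a b, a ≤ b → p b → p a) (hl' : ∀ x ∈ l', p x) : ∀ x ∈ l, p x := by
  induction h with
  | nil => exact hl'
  | cons hab _ ih =>
    rw [forall_mem_cons] at hl' ⊢
    exact ⟨hp _ _ hab hl'.1, ih hl'.2⟩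

theorem forall₂_concat_left_iff {β γ : Type*} {S : β → γ → Prop} {l : List β} {a : β}
    {l' : List γ} :
    Forall₂ S (l ++ [a]) l' ↔ ∃ k b, l' = k ++ [b] ∧ Forall₂ S l k ∧ S a b := by
  rw [← forall₂_reverse_iff, reverse_append, reverse_singleton, singleton_append,
    forall₂_cons_left_iff]
  constructor
  · rintro ⟨b, u, hab, hu, h⟩
    refine ⟨u.reverse, b, ?_, ?_, hab⟩
    · rw [← reverse_reverse l', h, reverse_cons]
    · rwa [← forall₂_reverse_iff, reverse_reverse]
  · rintro ⟨k, b, rfl, hk, hab⟩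
    exact ⟨b, k.reverse, hab, forall₂_reverse_iff.2 hk, by simp⟩

theorem Forall₂.concat {β γ : Type*} {S : β → γ → Prop} {l : List β} {a : β} {l' : List γ} {b : γ}
    (h : Forall₂ S l l') (hab : S a b) : Forall₂ S (l ++ [a]) (l' ++ [b]) :=
  forall₂_concat_left_iff.2 ⟨l', b, rfl, h, hab⟩

end List

section Representatives

variable {α : Type*} [LinearOrder α]

/-- A strictly increasing tuple without adjacent `r`-related entries. -/
def IsReducedTuple (r : α → α → Prop) (l : List α) : Prop :=
  l.IsChain fun a b => a < b ∧ ¬ r a b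

/-- A reduced tuple which is entrywise minimal among the equivalent reduced tuples. -/
def IsMinimalTuple (r : α → α → Prop) (l : List α) : Prop :=
  IsReducedTuple r l ∧ ∀ l', IsReducedTuple r l' → List.Forall₂ r l l' → List.Forall₂ (· ≤ ·) l l'

variable {r : α → α → Prop}

theorem IsReducedTuple.zipWith_min (hr : Equivalence r) {l l' : List α}
    (h : List.Forall₂ r l l') (hl : IsReducedTuple r l) (hl' : IsReducedTuple r l') :
    IsReducedTuple r (List.zipWith min l l') := by
  unfold IsReducedTuple at *
  induction h with
  | nil => exact .nil
  | @cons a b _ _ hab htail ih =>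
    cases htail with
    | nil => exact .singleton _
    | @cons c d _ _ hcd _ =>
      simp only [List.zipWith_cons_cons, List.isChain_cons_cons] at hl hl' ih ⊢
      refine ⟨⟨min_lt_min hl.1.1 hl'.1.1, fun hmin => hl.1.2 ?_⟩, ih hl.2 hl'.2⟩
      have ha : r a (min a b) := by
        rcases min_choice a b with h | h <;> rw [h]
        exacts [hr.refl a, hab]
      have hc : r c (min c d) := by
        rcases min_choice c d with h | h <;> rw [h]
        exacts [hr.refl c, hcd]
      exact hr.trans ha (hr.trans hmin (hr.symm hc))

theorem isReducedTuple_concat_concat {l : List α} {a b : α} :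
    IsReducedTuple r (l ++ [a] ++ [b]) ↔ IsReducedTuple r (l ++ [a]) ∧ a < b ∧ ¬ r a b := by
  unfold IsReducedTuple
  rw [List.isChain_append]
  simp

theorem IsReducedTuple.left_of_concat {l : List α} {a : α} (h : IsReducedTuple r (l ++ [a])) :
    IsReducedTuple r l :=
  (List.isChain_append.1 h).1

theorem IsReducedTuple.lt_of_mem {l : List α} {a : α} (h : IsReducedTuple r (l ++ [a])) :
    ∀ x ∈ l, x < a := by
  have hlt : (l ++ [a]).IsChain (· < ·) := h.imp fun _ _ h => h.1
  intro x hx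
  exact (List.pairwise_append.1 hlt.pairwise).2.2 x hx a (by simp)

/-- The last entry of a reduced tuple may be replaced by an equivalent one, and the entries before
it by equivalent ones, as long as the order is kept. -/
theorem IsReducedTuple.concat_of_forall₂ (hr : Equivalence r) {l l' : List α} {a b : α}
    (h : IsReducedTuple r (l ++ [a])) (hl' : IsReducedTuple r l') (hll' : List.Forall₂ r l l')
    (hab : r a b) (hb : ∀ x ∈ l', x < b) : IsReducedTuple r (l' ++ [b]) := by
  rcases List.eq_nil_or_concat' l with rfl | ⟨k, c, rfl⟩
  · rw [List.forall₂_nil_left_iff] at hll'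
    subst hll'
    exact .singleton _
  · obtain ⟨k', d, rfl, -, hcd⟩ := List.forall₂_concat_left_iff.1 hll'
    rw [isReducedTuple_concat_concat] at h ⊢
    exact ⟨hl', hb d (by simp),
      fun hdb => h.2.2 (hr.trans hcd (hr.trans hdb (hr.symm hab)))⟩

theorem IsMinimalTuple.left_of_concat (hr : Equivalence r) {l : List α} {a : α}
    (h : IsMinimalTuple r (l ++ [a])) : IsMinimalTuple r l := by
  refine ⟨h.1.left_of_concat, fun l' hl' hll' => ?_⟩
  have hmin := IsReducedTuple.zipWith_min hr hll' h.1.left_of_concat hl'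
  have hrel := hll'.zipWith_min_of_refl hr.refl
  have hlt : ∀ x ∈ List.zipWith min l l', x < a :=
    hll'.zipWith_min_le_left.forall_mem_le (fun _ _ => lt_of_le_of_lt) h.1.lt_of_mem
  have hle := h.2 _ (h.1.concat_of_forall₂ hr hmin hrel (hr.refl a) hlt) (hrel.concat (hr.refl a))
  obtain ⟨k, b, hk, hle, -⟩ := List.forall₂_concat_left_iff.1 hle
  obtain rfl := (List.append_inj' hk rfl).1
  have heq : List.zipWith min l l' = l :=
    hll'.zipWith_min_le_left.eq_or_lex_of_le.resolve_right hle.not_lex_of_le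
  rw [← heq]
  simpa [heq] using hll'.zipWith_min_le_right

theorem IsMinimalTuple.concat {l : List α} {a : α}
    (h : IsMinimalTuple r l) (hlt : ∀ x ∈ l, x < a)
    (hnew : ∀ b, r a b → (∀ x ∈ l, x < b) → a ≤ b) (hlast : ∀ x ∈ l.getLast?, ¬ r x a) :
    IsMinimalTuple r (l ++ [a]) := by
  refine ⟨List.isChain_append.2 ⟨h.1, .singleton _, ?_⟩, fun l' hl' hll' => ?_⟩
  · intro x hx y hy
    obtain rfl : a = y := by simpa using hy
    exact ⟨hlt x (List.mem_of_getLast? hx), hlast x hx⟩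
  · obtain ⟨k, b, rfl, hk, hab⟩ := List.forall₂_concat_left_iff.1 hll'
    have hle := h.2 k hl'.left_of_concat hk
    exact hle.concat
      (hnew b hab (hle.forall_mem_le (fun _ _ => lt_of_le_of_lt) hl'.lt_of_mem))

/-- A minimal tuple cannot end in an entry `a` equivalent to some smaller entry that is at least
all entries before `a`. -/
theorem not_isMinimalTuple_concat (hr : Equivalence r) {l : List α} {a b : α} (hba : b < a)
    (hrel : r b a) (hl : ∀ x ∈ l, x ≤ b) : ¬ IsMinimalTuple r (l ++ [a]) := by
  intro h
  have hlt : ∀ x ∈ l, x < b := by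
    rcases List.eq_nil_or_concat' l with rfl | ⟨k, c, rfl⟩
    · simp
    · have hc := (isReducedTuple_concat_concat.1 h.1)
      have hcb : c < b := by
        refine (hl c (by simp)).lt_of_ne ?_
        rintro rfl
        exact hc.2.2 hrel
      intro x hx
      rcases List.mem_append.1 hx with hx | hx
      · exact (hc.1.lt_of_mem x hx).trans hcb
      · simpa [List.mem_singleton.1 hx] using hcb
  have hrefl : List.Forall₂ r l l := List.forall₂_same.2 fun x _ => hr.refl x
  have hle := h.2 _ (h.1.concat_of_forall₂ hr h.1.left_of_concat hrefl (hr.symm hrel) hlt)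
    (hrefl.concat (hr.symm hrel))
  obtain ⟨k, c, hk, -, hac⟩ := List.forall₂_concat_left_iff.1 hle
  obtain rfl : b = c := by simpa using (List.append_inj' hk rfl).2
  exact hac.not_gt hba

end Representatives

section ImM

variable {n : ℕ} {r : Fin (n + 1) → Fin (n + 1) → Prop}

theorem isReducedTuple_iff {m : ℤ} {l : List (Fin (n + 1))} :
    IsATuple n m l ∧ ¬ HasAdjRel r l ↔ (∀ x ∈ l, (x : ℤ) ≤ m) ∧ IsReducedTuple r l := by
  have hlt : IsATuple n m l ↔ l.IsChain (· < ·) ∧ ∀ x ∈ l, (x : ℤ) ≤ m := Iff.rfl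
  rw [hlt]
  unfold HasAdjRel IsReducedTuple
  simp only [List.isChain_iff_getElem, List.get_eq_getElem]
  grind

theorem mem_ImM_iff (hr : Equivalence r) {m : ℤ} {l : List (Fin (n + 1))} :
    l ∈ ImM r m ↔ 0 ≤ m ∧ (∀ x ∈ l, (x : ℤ) ≤ m) ∧ IsMinimalTuple r l := by
  constructor
  · rintro ⟨hm, hl, hl', hmin⟩
    obtain ⟨hb, hred⟩ := isReducedTuple_iff.1 ⟨hl, hl'⟩
    refine ⟨hm, hb, hred, fun k hk hlk => ?_⟩
    have hle := hlk.zipWith_min_le_left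
    obtain ⟨h₁, h₂⟩ := isReducedTuple_iff.2
      ⟨hle.forall_mem_le (p := fun x => (x : ℤ) ≤ m)
        (fun a b hab hb => le_trans (by exact_mod_cast hab) hb) hb,
        IsReducedTuple.zipWith_min hr hlk hred hk⟩
    have heq := hle.eq_or_lex_of_le.resolve_right
      (hmin _ h₁ h₂ (hlk.zipWith_min_of_refl hr.refl))
    have := hlk.zipWith_min_le_right
    rwa [heq] at this
  · rintro ⟨hm, hb, hred, hmin⟩
    obtain ⟨h₁, h₂⟩ := isReducedTuple_iff.2 ⟨hb, hred⟩
    exact ⟨hm, h₁, h₂, fun k hk hk' hlk =>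
      (hmin k (isReducedTuple_iff.1 ⟨hk, hk'⟩).2 hlk).not_lex_of_le⟩

end ImM

/-- **Statement 10.** `Im M^{(n)}` is the disjoint union of `Im M^{(n−1)}` and
`ψ_n(Im M^{(n−1)} − Im M^{(n₀)})`; in particular `ψ_n(Im M^{(n₀−1)}) ∩ Im M^{(n)} = ∅`
and `ψ_n(Im M^{(n₀)} − Im M^{(n₀−1)}) ∩ Im M^{(n)} = ∅`. -/
theorem statement10 (n : ℕ) (hn : 1 ≤ n)
    (r : Fin (n + 1) → Fin (n + 1) → Prop) (hr : Equivalence r)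
    (hadj : ∀ i j : Fin (n + 1), r i j → (i : ℕ) + 1 ≠ (j : ℕ) ∧ (j : ℕ) + 1 ≠ (i : ℕ))
    (n₀ : ℤ)
    (hub : ∀ m : Fin (n + 1), m ≠ Fin.last n → r m (Fin.last n) → (m : ℤ) ≤ n₀)
    (hmem : (n₀ = -1 ∧ ∀ m : Fin (n + 1), m ≠ Fin.last n → ¬ r m (Fin.last n)) ∨
      (0 ≤ n₀ ∧ n₀ < (n : ℤ) ∧
        ∃ m : Fin (n + 1), (m : ℤ) = n₀ ∧ m ≠ Fin.last n ∧ r m (Fin.last n))) :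
    ImM r (n : ℤ) =
        ImM r ((n : ℤ) - 1) ∪
          (fun l => l ++ [Fin.last n]) '' (ImM r ((n : ℤ) - 1) \ ImM r n₀) ∧
      Disjoint (ImM r ((n : ℤ) - 1))
        ((fun l => l ++ [Fin.last n]) '' (ImM r ((n : ℤ) - 1) \ ImM r n₀)) ∧
      (fun l => l ++ [Fin.last n]) '' ImM r (n₀ - 1) ∩ ImM r (n : ℤ) = ∅ ∧
      (fun l => l ++ [Fin.last n]) '' (ImM r n₀ \ ImM r (n₀ - 1)) ∩ ImM r (n : ℤ) = ∅ := by
  have hlast : ∀ x : Fin (n + 1), x < Fin.last n ↔ (x : ℤ) ≤ (n : ℤ) - 1 := by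
    intro x
    rw [Fin.lt_def, Fin.val_last]
    omega
  have hnot : ∀ l, l ∈ ImM r n₀ → l ++ [Fin.last n] ∉ ImM r (n : ℤ) := by
    intro l hl hl'
    rw [mem_ImM_iff hr] at hl hl'
    rcases hmem with ⟨h, -⟩ | ⟨-, -, b, hb, hbn, hrel⟩
    · have := hl.1
      omega
    · refine not_isMinimalTuple_concat hr (lt_of_le_of_ne (Fin.le_last b) hbn) hrel ?_ hl'.2.2
      intro x hx
      have := hl.2.1 x hx
      rw [Fin.le_def]
      omega
  refine ⟨?_, ?_, ?_, ?_⟩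
  · ext l
    constructor
    · intro hl
      have hl' := (mem_ImM_iff hr).1 hl
      by_cases hb : ∀ x ∈ l, (x : ℤ) ≤ (n : ℤ) - 1
      · exact Or.inl ((mem_ImM_iff hr).2 ⟨by omega, hb, hl'.2.2⟩)
      · right
        rcases List.eq_nil_or_concat' l with rfl | ⟨k, a, rfl⟩
        · simp at hb
        · have hlt := hl'.2.2.1.lt_of_mem
          obtain rfl : a = Fin.last n := by
            by_contra ha
            have ha := lt_of_le_of_ne (Fin.le_last a) ha
            refine hb fun x hx => (hlast x).1 ?_
            rcases List.mem_append.1 hx with hx | hx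
            · exact (hlt x hx).trans ha
            · rwa [List.mem_singleton.1 hx]
          refine ⟨k, ⟨(mem_ImM_iff hr).2 ⟨by omega, fun x hx => (hlast x).1 (hlt x hx),
            hl'.2.2.left_of_concat hr⟩, fun hk => hnot k hk hl⟩, rfl⟩
    · rintro (hl | ⟨k, ⟨hk, hk₀⟩, rfl⟩)
      · rw [mem_ImM_iff hr] at hl ⊢
        exact ⟨by omega, fun x hx => (hl.2.1 x hx).trans (by omega), hl.2.2⟩
      · rw [mem_ImM_iff hr] at hk hk₀ ⊢
        have hlt : ∀ x ∈ k, x < Fin.last n := fun x hx => (hlast x).2 (hk.2.1 x hx)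
        have hnew : ∀ b, r (Fin.last n) b → (∀ x ∈ k, x ≤ b) → Fin.last n ≤ b := by
          intro b hrel hb
          by_contra hbn
          have hbn : b ≠ Fin.last n := fun h => hbn h.ge
          have hb₀ := hub b hbn (hr.symm hrel)
          refine hk₀ ⟨by omega, fun x hx => ?_, hk.2.2⟩
          have := Fin.le_def.1 (hb x hx)
          omega
        refine ⟨by omega, fun x _ => by have := x.is_le; omega,
          hk.2.2.concat hlt (fun b hrel hb => hnew b hrel fun x hx => (hb x hx).le) ?_⟩
        intro c hc hrel
        have hck := List.mem_of_getLast? hc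
        refine (hlt c hck).not_ge (hnew c (hr.symm hrel) fun x hx => ?_)
        rcases List.eq_nil_or_concat' k with rfl | ⟨k', d, rfl⟩
        · simp at hx
        · obtain rfl : d = c := by simpa using hc
          rcases List.mem_append.1 hx with hx | hx
          · exact (hk.2.2.1.lt_of_mem x hx).le
          · exact (List.mem_singleton.1 hx).le
  · rw [Set.disjoint_left]
    rintro _ hl ⟨k, -, rfl⟩
    have := ((mem_ImM_iff hr).1 hl).2.1 (Fin.last n) (by simp)
    rw [Fin.val_last] at this
    omega
  · rw [Set.eq_empty_iff_forall_notMem]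
    rintro _ ⟨⟨k, hk, rfl⟩, hl⟩
    refine hnot k ?_ hl
    rw [mem_ImM_iff hr] at hk ⊢
    exact ⟨by omega, fun x hx => (hk.2.1 x hx).trans (by omega), hk.2.2⟩
  · rw [Set.eq_empty_iff_forall_notMem]
    rintro _ ⟨⟨k, hk, rfl⟩, hl⟩
    exact hnot k hk.1 hl
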